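/- arXiv:math/0606474 — 7 statements merged into one kernel-verified Lean document; each statement's English description precedes it below -/
import Mathlib

section
/- A 5-tuple (f₁,f₂,f₃,f₄,f₅) ∈ ℝ[α₁,α₂,α₃]⁵ is GKM-admissible if and only if it is in parametric form, i.e. if and only if there exist p₁,…,p₅ ∈ ℝ[α₁,α₂,α₃] with f₁ = p₁, f₂ = p₁+α₂p₂, f₃ = p₁+(α₁+α₂)p₂+α₁(α₁+α₂)p₃, f₄ = p₁+(α₂+α₃)p₂+α₃(α₂+α₃)p₄, and f₅ = p₁+(α₁+α₂+α₃)p₂+α₁(α₁+α₂+α₃)p₃+α₃(α₁+α₂+α₃)p₄+α₁α₃(α₁+α₂+α₃)p₅. -/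
open MvPolynomial

/-- The polynomial ring ℝ[α₁,α₂,α₃]. -/
abbrev P3 : Type := MvPolynomial (Fin 3) ℝ

/-- A 5-tuple `(f₁,…,f₅)` is GKM-admissible if the eight divisibility conditions of the
moment graph of the Schubert variety `X(s₃s₁s₂) ⊂ G₂(ℂ⁴)` hold.  Here `X 0, X 1, X 2`
play the roles of `α₁, α₂, α₃` and `f i` (for `i = 0,…,4`) the roles of `f₁,…,f₅`. -/
def GKMAdmissible (f : Fin 5 → P3) : Prop :=
  (X 0 : P3) ∣ f 4 - f 3 ∧
  (X 2 : P3) ∣ f 4 - f 2 ∧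
  (X 0 + X 1 + X 2 : P3) ∣ f 4 - f 0 ∧
  (X 2 : P3) ∣ f 3 - f 1 ∧
  (X 1 + X 2 : P3) ∣ f 3 - f 0 ∧
  (X 0 : P3) ∣ f 2 - f 1 ∧
  (X 0 + X 1 : P3) ∣ f 2 - f 0 ∧
  (X 1 : P3) ∣ f 1 - f 0

/-- A factor that does not vanish identically on the hyperplane `X i = 0` can be cancelled from
a multiple of `X i`. -/
theorem MvPolynomial.X_dvd_of_X_dvd_mul_of_eval_ne_zero {σ R : Type*} [CommRing R] [IsDomain R]
    {i : σ} {g h : MvPolynomial σ R} (v : σ → R) (hv : v i = 0) (hg : eval v g ≠ 0)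
    (hdvd : X i ∣ g * h) : X i ∣ h := by
  refine (X_prime.dvd_or_dvd hdvd).resolve_left ?_
  rintro ⟨k, rfl⟩
  simp [hv] at hg

/-- A 5-tuple is GKM-admissible iff it is of the parametric form
`(p₁, p₁+α₂p₂, p₁+(α₁+α₂)p₂+α₁(α₁+α₂)p₃, p₁+(α₂+α₃)p₂+α₃(α₂+α₃)p₄,
  p₁+(α₁+α₂+α₃)p₂+α₁(α₁+α₂+α₃)p₃+α₃(α₁+α₂+α₃)p₄+α₁α₃(α₁+α₂+α₃)p₅)`. -/
theorem gkm_admissible_iff_parametric (f : Fin 5 → P3) :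
    GKMAdmissible f ↔
    ∃ p : Fin 5 → P3,
      f 0 = p 0 ∧
      f 1 = p 0 + X 1 * p 1 ∧
      f 2 = p 0 + (X 0 + X 1) * p 1 + X 0 * (X 0 + X 1) * p 2 ∧
      f 3 = p 0 + (X 1 + X 2) * p 1 + X 2 * (X 1 + X 2) * p 3 ∧
      f 4 = p 0 + (X 0 + X 1 + X 2) * p 1 + X 0 * (X 0 + X 1 + X 2) * p 2 +
            X 2 * (X 0 + X 1 + X 2) * p 3 + X 0 * X 2 * (X 0 + X 1 + X 2) * p 4 := by
  constructor
  · rintro ⟨⟨u₄₃, h₄₃⟩, ⟨u₄₂, h₄₂⟩, ⟨t, h₄₀⟩, ⟨u₃₁, h₃₁⟩, ⟨s, h₃₀⟩, ⟨u₂₁, h₂₁⟩, ⟨q, h₂₀⟩, ⟨p₁, h₁₀⟩⟩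
    obtain ⟨p₂, hp₂⟩ : (X 0 : P3) ∣ q - p₁ :=
      X_dvd_of_X_dvd_mul_of_eval_ne_zero (g := X 1) ![0, 1, 0] (by simp) (by simp)
        ⟨u₂₁ - q, by linear_combination h₂₁ - h₂₀ + h₁₀⟩
    obtain ⟨p₃, hp₃⟩ : (X 2 : P3) ∣ s - p₁ :=
      X_dvd_of_X_dvd_mul_of_eval_ne_zero (g := X 1) ![0, 1, 0] (by simp) (by simp)
        ⟨u₃₁ - s, by linear_combination h₃₁ - h₃₀ + h₁₀⟩
    obtain ⟨y, hy⟩ : (X 0 : P3) ∣ t - s :=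
      X_dvd_of_X_dvd_mul_of_eval_ne_zero (g := X 1 + X 2) ![0, 1, 0] (by simp) (by simp)
        ⟨u₄₃ - t, by linear_combination h₄₃ - h₄₀ + h₃₀⟩
    obtain ⟨w, hw⟩ : (X 2 : P3) ∣ t - q :=
      X_dvd_of_X_dvd_mul_of_eval_ne_zero (g := X 0 + X 1) ![0, 1, 0] (by simp) (by simp)
        ⟨u₄₂ - t, by linear_combination h₄₂ - h₄₀ + h₂₀⟩
    obtain ⟨p₄, hp₄⟩ : (X 0 : P3) ∣ w - p₃ :=
      X_dvd_of_X_dvd_mul_of_eval_ne_zero (g := X 2) ![0, 0, 1] (by simp) (by simp)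
        ⟨y - p₂, by linear_combination hy - hw - hp₂ + hp₃⟩
    refine ⟨![f 0, p₁, p₂, p₃, p₄], rfl, ?_, ?_, ?_, ?_⟩
    · change f 1 = f 0 + X 1 * p₁
      linear_combination h₁₀
    · change f 2 = f 0 + (X 0 + X 1) * p₁ + X 0 * (X 0 + X 1) * p₂
      linear_combination h₂₀ + (X 0 + X 1) * hp₂
    · change f 3 = f 0 + (X 1 + X 2) * p₁ + X 2 * (X 1 + X 2) * p₃
      linear_combination h₃₀ + (X 1 + X 2) * hp₃
    · change f 4 = f 0 + (X 0 + X 1 + X 2) * p₁ + X 0 * (X 0 + X 1 + X 2) * p₂ +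
        X 2 * (X 0 + X 1 + X 2) * p₃ + X 0 * X 2 * (X 0 + X 1 + X 2) * p₄
      linear_combination h₄₀ + (X 0 + X 1 + X 2) * (hw + hp₂ + X 2 * hp₄)
  · rintro ⟨p, h₀, h₁, h₂, h₃, h₄⟩
    simp only [GKMAdmissible, h₀, h₁, h₂, h₃, h₄]
    refine ⟨⟨p 1 + (X 0 + X 1 + X 2) * p 2 + X 2 * p 3 + X 2 * (X 0 + X 1 + X 2) * p 4, by ring⟩,
      ⟨p 1 + X 0 * p 2 + (X 0 + X 1 + X 2) * p 3 + X 0 * (X 0 + X 1 + X 2) * p 4, by ring⟩,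
      ⟨p 1 + X 0 * p 2 + X 2 * p 3 + X 0 * X 2 * p 4, by ring⟩,
      ⟨p 1 + (X 1 + X 2) * p 3, by ring⟩, ⟨p 1 + X 2 * p 3, by ring⟩,
      ⟨p 1 + (X 0 + X 1) * p 2, by ring⟩, ⟨p 1 + X 0 * p 2, by ring⟩, ⟨p 1, by ring⟩⟩
end

section
/- The set of GKM-admissible 5-tuples in ℝ[α₁,α₂,α₃]⁵ is a free ℝ[α₁,α₂,α₃]-module of rank 5, with basis B₁ = (1,1,1,1,1), B₂ = (0, α₂, α₁+α₂, α₂+α₃, α₁+α₂+α₃), B₃ = (0, 0, α₁(α₁+α₂), 0, α₁(α₁+α₂+α₃)), B₄ = (0, 0, 0, α₃(α₂+α₃), α₃(α₁+α₂+α₃)), B₅ = (0, 0, 0, 0, α₁α₃(α₁+α₂+α₃)); that is, every GKM-admissible tuple is an ℝ[α₁,α₂,α₃]-linear combination of B₁,…,B₅ with uniquely determined coefficients p₁,…,p₅. -/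
open MvPolynomial

/-- The basis `B₁,…,B₅` of the module of GKM-admissible tuples:
`B₁ = (1,1,1,1,1)`, `B₂ = (0, α₂, α₁+α₂, α₂+α₃, α₁+α₂+α₃)`,
`B₃ = (0, 0, α₁(α₁+α₂), 0, α₁(α₁+α₂+α₃))`, `B₄ = (0, 0, 0, α₃(α₂+α₃), α₃(α₁+α₂+α₃))`,
`B₅ = (0, 0, 0, 0, α₁α₃(α₁+α₂+α₃))`. -/
noncomputable def gkmBasis : Fin 5 → (Fin 5 → P3) :=
  ![![1, 1, 1, 1, 1],
    ![0, X 1, X 0 + X 1, X 1 + X 2, X 0 + X 1 + X 2],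
    ![0, 0, X 0 * (X 0 + X 1), 0, X 0 * (X 0 + X 1 + X 2)],
    ![0, 0, 0, X 2 * (X 1 + X 2), X 2 * (X 0 + X 1 + X 2)],
    ![0, 0, 0, 0, X 0 * X 2 * (X 0 + X 1 + X 2)]]

/-- A variable does not divide a polynomial that is nonzero at a point of its coordinate
hyperplane. -/
lemma not_X_dvd_of_eval_ne_zero {σ R : Type*} [CommSemiring R] {i : σ} {L : MvPolynomial σ R}
    (v : σ → R) (hv : v i = 0) (hL : eval v L ≠ 0) : ¬ (X i : MvPolynomial σ R) ∣ L := by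
  rintro ⟨k, rfl⟩
  simp [hv] at hL

/-- If a prime and a non-multiple of it both divide `g`, so does their product. -/
lemma Prime.mul_dvd_of_dvd_of_not_dvd {R : Type*} [CommMonoidWithZero R] {p L g : R}
    (hp : Prime p) (hpL : ¬ p ∣ L) (hpg : p ∣ g) (hLg : L ∣ g) : p * L ∣ g := by
  obtain ⟨k, rfl⟩ := hLg
  rw [mul_comm p]
  exact mul_dvd_mul_left L ((hp.dvd_or_dvd hpg).resolve_left hpL)

lemma gkmAdmissible_gkmBasis (i : Fin 5) : GKMAdmissible (gkmBasis i) := by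
  fin_cases i
  · simp [GKMAdmissible, gkmBasis]
  · refine ⟨⟨1, ?_⟩, ⟨1, ?_⟩, ⟨1, ?_⟩, ⟨1, ?_⟩, ⟨1, ?_⟩, ⟨1, ?_⟩, ⟨1, ?_⟩, ⟨1, ?_⟩⟩ <;>
      simp [gkmBasis]
  · refine ⟨⟨X 0 + X 1 + X 2, ?_⟩, ⟨X 0, ?_⟩, ⟨X 0, ?_⟩, ⟨0, ?_⟩, ⟨0, ?_⟩, ⟨X 0 + X 1, ?_⟩,
      ⟨X 0, ?_⟩, ⟨0, ?_⟩⟩ <;> simp [gkmBasis] <;> ring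
  · refine ⟨⟨X 2, ?_⟩, ⟨X 0 + X 1 + X 2, ?_⟩, ⟨X 2, ?_⟩, ⟨X 1 + X 2, ?_⟩, ⟨X 2, ?_⟩, ⟨0, ?_⟩,
      ⟨0, ?_⟩, ⟨0, ?_⟩⟩ <;> simp [gkmBasis] <;> ring
  · refine ⟨⟨X 2 * (X 0 + X 1 + X 2), ?_⟩, ⟨X 0 * (X 0 + X 1 + X 2), ?_⟩, ⟨X 0 * X 2, ?_⟩,
      ⟨0, ?_⟩, ⟨0, ?_⟩, ⟨0, ?_⟩, ⟨0, ?_⟩, ⟨0, ?_⟩⟩ <;> simp [gkmBasis] <;> ring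

lemma eq_sum_smul_gkmBasis_iff (f p : Fin 5 → P3) :
    f = ∑ i : Fin 5, p i • gkmBasis i ↔
      f 0 = p 0 ∧
      f 1 = p 0 + p 1 * X 1 ∧
      f 2 = p 0 + p 1 * (X 0 + X 1) + p 2 * (X 0 * (X 0 + X 1)) ∧
      f 3 = p 0 + p 1 * (X 1 + X 2) + p 3 * (X 2 * (X 1 + X 2)) ∧
      f 4 = p 0 + p 1 * (X 0 + X 1 + X 2) + p 2 * (X 0 * (X 0 + X 1 + X 2)) +
        p 3 * (X 2 * (X 0 + X 1 + X 2)) + p 4 * (X 0 * X 2 * (X 0 + X 1 + X 2)) := by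
  simp [funext_iff, Fin.forall_fin_succ, Fin.sum_univ_succ, gkmBasis, add_assoc]

/-- The set of GKM-admissible 5-tuples is a free `ℝ[α₁,α₂,α₃]`-module of rank 5 with
basis `B₁,…,B₅`: each `Bᵢ` is GKM-admissible, and every GKM-admissible tuple is an
`ℝ[α₁,α₂,α₃]`-linear combination of `B₁,…,B₅` with uniquely determined coefficients. -/
theorem gkm_admissible_free_module_rank_five :
    (∀ i : Fin 5, GKMAdmissible (gkmBasis i)) ∧
    (∀ f : Fin 5 → P3, GKMAdmissible f →
      ∃! p : Fin 5 → P3, f = ∑ i : Fin 5, p i • gkmBasis i) := by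
  refine ⟨gkmAdmissible_gkmBasis, fun f hf => ?_⟩
  simp only [eq_sum_smul_gkmBasis_iff]
  have h01 : ¬ (X 0 : P3) ∣ X 0 + X 1 :=
    not_X_dvd_of_eval_ne_zero ![0, 1, 1] (by simp) (by simp)
  have h21 : ¬ (X 2 : P3) ∣ X 1 + X 2 :=
    not_X_dvd_of_eval_ne_zero ![1, 1, 0] (by simp) (by simp)
  have h0 : ¬ (X 0 : P3) ∣ X 0 + X 1 + X 2 :=
    not_X_dvd_of_eval_ne_zero ![0, 1, 1] (by simp) (by simp)
  have h2 : ¬ (X 2 : P3) ∣ X 0 * (X 0 + X 1 + X 2) :=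
    not_X_dvd_of_eval_ne_zero ![1, 1, 0] (by simp) (by simp)
  have hp0 : Prime (X 0 : P3) := X_prime
  have hp2 : Prime (X 2 : P3) := X_prime
  have hX1 : (X 1 : P3) ≠ 0 := X_ne_zero 1
  have hL3 : (X 0 * (X 0 + X 1) : P3) ≠ 0 :=
    mul_ne_zero hp0.ne_zero fun h => h01 (h ▸ dvd_zero _)
  have hL4 : (X 2 * (X 1 + X 2) : P3) ≠ 0 :=
    mul_ne_zero hp2.ne_zero fun h => h21 (h ▸ dvd_zero _)
  have hL5 : (X 0 * X 2 * (X 0 + X 1 + X 2) : P3) ≠ 0 :=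
    mul_ne_zero (mul_ne_zero hp0.ne_zero hp2.ne_zero) fun h => h0 (h ▸ dvd_zero _)
  obtain ⟨⟨a, ha⟩, ⟨b, hb⟩, ⟨c, hc⟩, ⟨d, hd⟩, ⟨e, he⟩, ⟨r, hr⟩, ⟨s, hs⟩, ⟨t, ht⟩⟩ := hf
  obtain ⟨u, hu⟩ : (X 0 * (X 0 + X 1) : P3) ∣ f 2 - f 0 - t * (X 0 + X 1) :=
    hp0.mul_dvd_of_dvd_of_not_dvd h01 ⟨r - t, by linear_combination hr + ht⟩
      ⟨s - t, by linear_combination hs⟩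
  obtain ⟨v, hv⟩ : (X 2 * (X 1 + X 2) : P3) ∣ f 3 - f 0 - t * (X 1 + X 2) :=
    hp2.mul_dvd_of_dvd_of_not_dvd h21 ⟨d - t, by linear_combination hd + ht⟩
      ⟨e - t, by linear_combination he⟩
  obtain ⟨w, hw⟩ : (X 2 * (X 0 * (X 0 + X 1 + X 2)) : P3) ∣
      f 4 - f 0 - (t + u * X 0 + v * X 2) * (X 0 + X 1 + X 2) :=
    hp2.mul_dvd_of_dvd_of_not_dvd h2
      ⟨b - t - u * X 0 - v * (X 0 + X 1 + X 2), by linear_combination hb + hu⟩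
      (hp0.mul_dvd_of_dvd_of_not_dvd h0
        ⟨a - t - v * X 2 - u * (X 0 + X 1 + X 2), by linear_combination ha + hv⟩
        ⟨c - (t + u * X 0 + v * X 2), by linear_combination hc⟩)
  refine ⟨![f 0, t, u, v, w], ⟨rfl, ?_, ?_, ?_, ?_⟩, ?_⟩
  · simp; linear_combination ht
  · simp; linear_combination hu
  · simp; linear_combination hv
  · simp; linear_combination hw
  · rintro q ⟨q0, q1, q2, q3, q4⟩
    have e1 : q 1 = t := mul_right_cancel₀ hX1 (by linear_combination ht + q0 - q1)
    rw [← q0, e1] at q2 q3 q4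
    have e2 : q 2 = u := mul_right_cancel₀ hL3 (by linear_combination hu - q2)
    have e3 : q 3 = v := mul_right_cancel₀ hL4 (by linear_combination hv - q3)
    rw [e2, e3] at q4
    have e4 : q 4 = w := mul_right_cancel₀ hL5 (by linear_combination hw - q4)
    ext1 i
    fin_cases i <;> simp [*]
end

section
/- For all f₄', f₅' ∈ ℝ[α₁,α₂,α₃] such that α₁ divides f₅' − f₄', there exists a GKM-admissible 5-tuple (f₁,f₂,f₃,f₄,f₅) with f₄ = f₄' and f₅ = f₅'. Explicitly, writing f₄' = f₅' + α₁g for some g ∈ ℝ[α₁,α₂,α₃], the tuple f₁ = f₅'+(α₁+α₂+α₃)g, f₂ = f₅'+(α₁+α₃)g, f₃ = f₅'+α₃g, f₄ = f₅'+α₁g, f₅ = f₅' is GKM-admissible. (This verifies Assumption 3(ii) of the paper for the moment graph of X(s₃s₁s₂) when the truncated graph Γ_{r₀} consists of the two vertices s₃s₂λ and s₃s₁s₂λ joined by an edge labelled α₁.) -/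
open MvPolynomial

/-- The explicit extension of a class on the top edge, written in terms of `f₅'` and `g`, is
GKM-admissible. -/
theorem gkmAdmissible_topEdgeExtension (f₅' g : P3) : GKMAdmissible
    ![f₅' + (X 0 + X 1 + X 2) * g,
      f₅' + (X 0 + X 2) * g,
      f₅' + X 2 * g,
      f₅' + X 0 * g,
      f₅'] := by
  refine ⟨?_, ?_, ?_, ?_, ?_, ?_, ?_, ?_⟩ <;>
    exact ⟨-g, by dsimp; ring⟩

/-- Any pair `(f₄', f₅')` with `α₁ ∣ f₅' − f₄'` extends to a GKM-admissible 5-tuple;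
explicitly, writing `f₄' = f₅' + α₁ g`, the tuple
`(f₅'+(α₁+α₂+α₃)g, f₅'+(α₁+α₃)g, f₅'+α₃g, f₅'+α₁g, f₅')` is GKM-admissible.
This verifies Assumption 3(ii) for the truncated moment graph `Γ_{r₀}` with the two
vertices `s₃s₂λ`, `s₃s₁s₂λ` joined by an edge labelled `α₁`. -/
theorem gkm_extension_from_top_edge :
    (∀ f₄' f₅' : P3, (X 0 : P3) ∣ f₅' - f₄' →
      ∃ f : Fin 5 → P3, GKMAdmissible f ∧ f 3 = f₄' ∧ f 4 = f₅') ∧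
    (∀ f₅' g : P3, GKMAdmissible
      ![f₅' + (X 0 + X 1 + X 2) * g,
        f₅' + (X 0 + X 2) * g,
        f₅' + X 2 * g,
        f₅' + X 0 * g,
        f₅']) := by
  refine ⟨fun f₄' f₅' ⟨h, hh⟩ => ?_, gkmAdmissible_topEdgeExtension⟩
  refine ⟨_, gkmAdmissible_topEdgeExtension f₅' (-h), ?_, rfl⟩
  change f₅' + X 0 * -h = f₄'
  linear_combination hh
end

section
/- Let a₁,a₂,a₃ be negative real numbers and let φ : ℝ[α₁,α₂,α₃] → ℝ[ν] be the ℝ-algebra homomorphism with φ(αᵢ) = aᵢν for i = 1,2,3. Then the image of the set of GKM-admissible 5-tuples under the componentwise map φ⁵ : ℝ[α₁,α₂,α₃]⁵ → ℝ[ν]⁵ is exactly the set R of 5-tuples of the form (q₁, q₁+a₂νq₂, q₁+(a₁+a₂)νq₂+a₁(a₁+a₂)ν²q₃, q₁+(a₂+a₃)νq₂+a₃(a₂+a₃)ν²q₄, q₁+(a₁+a₂+a₃)νq₂+a₁(a₁+a₂+a₃)ν²q₃+a₃(a₁+a₂+a₃)ν²q₄+ν³q₅) with q₁,…,q₅ ∈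 ℝ[ν]. -/
open MvPolynomial

/-- The ℝ-algebra homomorphism `φ : ℝ[α₁,α₂,α₃] → ℝ[ν]` with `φ(αᵢ) = aᵢ ν`,
where `a 0, a 1, a 2` play the roles of `a₁, a₂, a₃`. -/
noncomputable def phi (a : Fin 3 → ℝ) : P3 →ₐ[ℝ] Polynomial ℝ :=
  MvPolynomial.aeval (fun i => Polynomial.C (a i) * Polynomial.X)

/-- The set `R ⊆ ℝ[ν]⁵` of 5-tuples of the form
`(q₁, q₁+a₂νq₂, q₁+(a₁+a₂)νq₂+a₁(a₁+a₂)ν²q₃, q₁+(a₂+a₃)νq₂+a₃(a₂+a₃)ν²q₄,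
  q₁+(a₁+a₂+a₃)νq₂+a₁(a₁+a₂+a₃)ν²q₃+a₃(a₁+a₂+a₃)ν²q₄+ν³q₅)`
with `q₁,…,q₅ ∈ ℝ[ν]`. -/
noncomputable def Rcarrier (a : Fin 3 → ℝ) : Set (Fin 5 → Polynomial ℝ) :=
  {f | ∃ q : Fin 5 → Polynomial ℝ,
    f 0 = q 0 ∧
    f 1 = q 0 + Polynomial.C (a 1) * Polynomial.X * q 1 ∧
    f 2 = q 0 + Polynomial.C (a 0 + a 1) * Polynomial.X * q 1 +
          Polynomial.C (a 0 * (a 0 + a 1)) * Polynomial.X ^ 2 * q 2 ∧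
    f 3 = q 0 + Polynomial.C (a 1 + a 2) * Polynomial.X * q 1 +
          Polynomial.C (a 2 * (a 1 + a 2)) * Polynomial.X ^ 2 * q 3 ∧
    f 4 = q 0 + Polynomial.C (a 0 + a 1 + a 2) * Polynomial.X * q 1 +
          Polynomial.C (a 0 * (a 0 + a 1 + a 2)) * Polynomial.X ^ 2 * q 2 +
          Polynomial.C (a 2 * (a 0 + a 1 + a 2)) * Polynomial.X ^ 2 * q 3 +
          Polynomial.X ^ 3 * q 4}

/-- A variable can be cancelled from a product whose other factor does not vanish at some point
where that variable vanishes. -/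
theorem X_dvd_of_dvd_mul_left {i : Fin 3} {l g : P3} (v : Fin 3 → ℝ) (hv : v i = 0)
    (hl : eval v l ≠ 0) (h : (X i : P3) ∣ l * g) : (X i : P3) ∣ g := by
  refine ((MvPolynomial.X_prime (i := i)).dvd_or_dvd h).resolve_left ?_
  rintro ⟨t, rfl⟩
  simp [hv] at hl

/-- Every GKM-admissible tuple is a combination of the five basis classes. -/
theorem GKMAdmissible.exists_basis {f : Fin 5 → P3} (hf : GKMAdmissible f) :
    ∃ p : Fin 5 → P3,
      f 0 = p 0 ∧
      f 1 = p 0 + X 1 * p 1 ∧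
      f 2 = p 0 + (X 0 + X 1) * p 1 + X 0 * (X 0 + X 1) * p 2 ∧
      f 3 = p 0 + (X 1 + X 2) * p 1 + X 2 * (X 1 + X 2) * p 3 ∧
      f 4 = p 0 + (X 0 + X 1 + X 2) * p 1 + X 0 * (X 0 + X 1 + X 2) * p 2 +
        X 2 * (X 0 + X 1 + X 2) * p 3 + X 0 * X 2 * (X 0 + X 1 + X 2) * p 4 := by
  obtain ⟨⟨c43, h43⟩, ⟨c42, h42⟩, ⟨c40, h40⟩, ⟨c31, h31⟩, ⟨c30, h30⟩, ⟨c21, h21⟩,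
    ⟨c20, h20⟩, ⟨c10, h10⟩⟩ := hf
  obtain ⟨p2, hp2⟩ : (X 0 : P3) ∣ c20 - c10 :=
    X_dvd_of_dvd_mul_left (l := X 1) ![0, 1, 0] (by simp) (by simp)
      ⟨c21 - c20, by linear_combination h21 - h20 + h10⟩
  obtain ⟨p3, hp3⟩ : (X 2 : P3) ∣ c30 - c10 :=
    X_dvd_of_dvd_mul_left (l := X 1) ![0, 1, 0] (by simp) (by simp)
      ⟨c31 - c30, by linear_combination h31 - h30 + h10⟩
  obtain ⟨t, ht⟩ : (X 0 : P3) ∣ c40 - c10 - X 0 * p2 - X 2 * p3 :=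
    X_dvd_of_dvd_mul_left (l := X 0 + X 1 + X 2) ![0, 1, 0] (by simp) (by simp)
      ⟨c43 - c10 - (X 0 + X 1 + X 2) * p2 - X 2 * p3, by
        linear_combination h43 - h40 + h30 + (X 1 + X 2) * hp3⟩
  obtain ⟨p4, hp4⟩ : (X 2 : P3) ∣ t :=
    X_dvd_of_dvd_mul_left (l := (X 0 + X 1 + X 2) * X 0) ![1, 0, 0] (by simp) (by simp)
      ⟨c42 - c10 - (X 0 + X 1 + X 2) * p3 - X 0 * p2, by
        linear_combination h42 - h40 + h20 + (X 0 + X 1) * hp2 - (X 0 + X 1 + X 2) * ht⟩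
  refine ⟨![f 0, c10, p2, p3, p4], rfl, ?_, ?_, ?_, ?_⟩ <;> simp only [Matrix.cons_val]
  · linear_combination h10
  · linear_combination h20 + (X 0 + X 1) * hp2
  · linear_combination h30 + (X 1 + X 2) * hp3
  · linear_combination h40 + (X 0 + X 1 + X 2) * ht + (X 0 + X 1 + X 2) * X 0 * hp4

/-- Every combination of the five basis classes is GKM-admissible. -/
theorem gkmAdmissible_of_basis (p : Fin 5 → P3) :
    GKMAdmissible ![p 0, p 0 + X 1 * p 1,
      p 0 + (X 0 + X 1) * p 1 + X 0 * (X 0 + X 1) * p 2,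
      p 0 + (X 1 + X 2) * p 1 + X 2 * (X 1 + X 2) * p 3,
      p 0 + (X 0 + X 1 + X 2) * p 1 + X 0 * (X 0 + X 1 + X 2) * p 2 +
        X 2 * (X 0 + X 1 + X 2) * p 3 + X 0 * X 2 * (X 0 + X 1 + X 2) * p 4] := by
  refine ⟨⟨p 1 + (X 0 + X 1 + X 2) * p 2 + X 2 * p 3 + X 2 * (X 0 + X 1 + X 2) * p 4, ?_⟩,
    ⟨p 1 + X 0 * p 2 + (X 0 + X 1 + X 2) * p 3 + X 0 * (X 0 + X 1 + X 2) * p 4, ?_⟩,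
    ⟨p 1 + X 0 * p 2 + X 2 * p 3 + X 0 * X 2 * p 4, ?_⟩,
    ⟨p 1 + (X 1 + X 2) * p 3, ?_⟩, ⟨p 1 + X 2 * p 3, ?_⟩,
    ⟨p 1 + (X 0 + X 1) * p 2, ?_⟩, ⟨p 1 + X 0 * p 2, ?_⟩, ⟨p 1, ?_⟩⟩ <;>
  · simp only [Matrix.cons_val]
    ring

@[simp]
theorem phi_X (a : Fin 3 → ℝ) (i : Fin 3) :
    phi a (X i) = Polynomial.C (a i) * Polynomial.X := by
  simp [phi]

theorem phi_surjective {a : Fin 3 → ℝ} {i : Fin 3} (hi : a i ≠ 0) :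
    Function.Surjective (phi a) := by
  intro q
  refine ⟨Polynomial.aeval (C (a i)⁻¹ * X i : P3) q, ?_⟩
  have hX : phi a (C (a i)⁻¹ * X i) = Polynomial.X := by
    rw [map_mul, phi_X, ← algebraMap_eq, AlgHom.commutes, Polynomial.algebraMap_eq, ← mul_assoc,
      ← Polynomial.C_mul, inv_mul_cancel₀ hi, Polynomial.C_1, one_mul]
  rw [← Polynomial.aeval_algHom_apply, hX, Polynomial.aeval_X_left_apply]

/-- For negative `a₁, a₂, a₃`, the image of the set of GKM-admissible 5-tuples under the
componentwise substitution `αᵢ ↦ aᵢ ν` is exactly the set `R`. -/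
theorem image_gkm_admissible_eq_Rcarrier (a : Fin 3 → ℝ) (ha : ∀ i, a i < 0) :
    (fun f : Fin 5 → P3 => (phi a) ∘ f) '' {f | GKMAdmissible f} = Rcarrier a := by
  have hne : a 0 * a 2 * (a 0 + a 1 + a 2) ≠ 0 :=
    mul_ne_zero (mul_ne_zero (ha 0).ne (ha 2).ne) (by linarith [ha 0, ha 1, ha 2])
  ext g
  constructor
  · rintro ⟨f, hf, rfl⟩
    obtain ⟨p, h0, h1, h2, h3, h4⟩ := GKMAdmissible.exists_basis hf
    refine ⟨![phi a (p 0), phi a (p 1), phi a (p 2), phi a (p 3),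
      Polynomial.C (a 0 * a 2 * (a 0 + a 1 + a 2)) * phi a (p 4)], ?_, ?_, ?_, ?_, ?_⟩ <;>
    · simp only [Function.comp_apply, h0, h1, h2, h3, h4, map_add, map_mul, phi_X,
        Matrix.cons_val]
      try ring
  · rintro ⟨q, h0, h1, h2, h3, h4⟩
    choose r hr using phi_surjective (ha 0).ne
    have hc : Polynomial.C (a 0 * a 2 * (a 0 + a 1 + a 2)) *
        Polynomial.C (a 0 * a 2 * (a 0 + a 1 + a 2))⁻¹ = 1 := by
      rw [← Polynomial.C_mul, mul_inv_cancel₀ hne, Polynomial.C_1]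
    refine ⟨_, gkmAdmissible_of_basis ![r (q 0), r (q 1), r (q 2), r (q 3),
      r (Polynomial.C (a 0 * a 2 * (a 0 + a 1 + a 2))⁻¹ * q 4)], ?_⟩
    ext1 j
    fin_cases j <;>
      simp only [Function.comp_apply, Fin.zero_eta, Fin.mk_one, Fin.reduceFinMk,
        Matrix.cons_val, map_add, map_mul, phi_X, hr, h0, h1, h2, h3, h4] at hc ⊢
    · ring
    · ring
    · linear_combination Polynomial.X ^ 3 * q 4 * hc
end

section
/- Let a₁,a₂,a₃ be negative real numbers. Then the set R of 5-tuples of the form (q₁, q₁+a₂νq₂, q₁+(a₁+a₂)νq₂+a₁(a₁+a₂)ν²q₃, q₁+(a₂+a₃)νq₂+a₃(a₂+a₃)ν²q₄, q₁+(a₁+a₂+a₃)νq₂+a₁(a₁+a₂+a₃)ν²q₃+a₃(a₁+a₂+a₃)ν²q₄+ν³q₅), with q₁,…,q₅ ∈ ℝ[ν], is an ℝ-subalgebra of the product ring ℝ[ν]⁵ (componentwise operations): it contains the diagonal constants and is closed under componentwise addition and multiplication. -/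
open Polynomial in
theorem C_mem_Rcarrier (a : Fin 3 → ℝ) (c : ℝ) :
    (fun _ => C c : Fin 5 → ℝ[X]) ∈ Rcarrier a :=
  ⟨![C c, 0, 0, 0, 0], by simp⟩

open Polynomial in
theorem add_mem_Rcarrier (a : Fin 3 → ℝ) {f g : Fin 5 → ℝ[X]}
    (hf : f ∈ Rcarrier a) (hg : g ∈ Rcarrier a) : f + g ∈ Rcarrier a := by
  obtain ⟨p, hp0, hp1, hp2, hp3, hp4⟩ := hf
  obtain ⟨q, hq0, hq1, hq2, hq3, hq4⟩ := hg
  refine ⟨p + q, ?_, ?_, ?_, ?_, ?_⟩ <;>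
    simp only [Pi.add_apply, hp0, hp1, hp2, hp3, hp4, hq0, hq1, hq2, hq3, hq4] <;> ring

open Polynomial in
theorem mul_mem_Rcarrier (a : Fin 3 → ℝ) {f g : Fin 5 → ℝ[X]}
    (hf : f ∈ Rcarrier a) (hg : g ∈ Rcarrier a) : f * g ∈ Rcarrier a := by
  obtain ⟨p, hp0, hp1, hp2, hp3, hp4⟩ := hf
  obtain ⟨q, hq0, hq1, hq2, hq3, hq4⟩ := hg
  let b := C (a 0) + C (a 1)
  let c := C (a 1) + C (a 2)
  let s := C (a 0) + C (a 1) + C (a 2)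
  let P := C (a 0) * s * p 2 + C (a 2) * s * p 3
  let Q := C (a 0) * s * q 2 + C (a 2) * s * q 3
  refine ⟨![p 0 * q 0,
    p 0 * q 1 + p 1 * q 0 + C (a 1) * X * (p 1 * q 1),
    p 1 * q 1 + p 0 * q 2 + p 2 * q 0 + b * X * (p 1 * q 2 + p 2 * q 1) +
      C (a 0) * b * X ^ 2 * (p 2 * q 2),
    p 1 * q 1 + p 0 * q 3 + p 3 * q 0 + c * X * (p 1 * q 3 + p 3 * q 1) +
      C (a 2) * c * X ^ 2 * (p 3 * q 3),
    s * (p 1 * Q + P * q 1) + X * P * Q -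
      C (a 0) * s * (b * (p 1 * q 2 + p 2 * q 1) + C (a 0) * b * X * (p 2 * q 2)) -
      C (a 2) * s * (c * (p 1 * q 3 + p 3 * q 1) + C (a 2) * c * X * (p 3 * q 3)) +
      p 0 * q 4 + p 4 * q 0 + s * X * (p 1 * q 4 + p 4 * q 1) +
      X ^ 2 * (P * q 4 + p 4 * Q) + X ^ 3 * (p 4 * q 4)], ?_, ?_, ?_, ?_, ?_⟩ <;>
    simp [hp0, hp1, hp2, hp3, hp4, hq0, hq1, hq2, hq3, hq4, b, c, s, P, Q] <;> ring

/-- For negative `a₁, a₂, a₃`, the set `R` contains the diagonal constants, is closed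
under componentwise addition and multiplication, and is (the carrier of) an
ℝ-subalgebra of the product ring `ℝ[ν]⁵`. -/
theorem Rcarrier_subalgebra (a : Fin 3 → ℝ) (ha : ∀ i, a i < 0) :
    (∀ c : ℝ, (fun _ => Polynomial.C c : Fin 5 → Polynomial ℝ) ∈ Rcarrier a) ∧
    (∀ f g : Fin 5 → Polynomial ℝ,
      f ∈ Rcarrier a → g ∈ Rcarrier a → f + g ∈ Rcarrier a) ∧
    (∀ f g : Fin 5 → Polynomial ℝ,
      f ∈ Rcarrier a → g ∈ Rcarrier a → f * g ∈ Rcarrier a) ∧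
    (∃ A : Subalgebra ℝ (Fin 5 → Polynomial ℝ),
      (A : Set (Fin 5 → Polynomial ℝ)) = Rcarrier a) := by
  refine ⟨C_mem_Rcarrier a, fun _ _ => add_mem_Rcarrier a, fun _ _ => mul_mem_Rcarrier a, ?_⟩
  exact ⟨{ carrier := Rcarrier a
           mul_mem' := mul_mem_Rcarrier a
           add_mem' := add_mem_Rcarrier a
           algebraMap_mem' := C_mem_Rcarrier a }, rfl⟩
end

section
/- Let a₁,a₂,a₃ be negative real numbers, R the subalgebra of ℝ[ν]⁵ defined above, and K₋ the ideal of R generated by the single element (0,0,0,0,ν³). Then K₋ = {x ∈ R : x₁ = x₂ = x₃ = x₄ = 0} = {(0,0,0,0,ν³q) : q ∈ ℝ[ν]}. -/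
open Polynomial in
theorem const_mem_Rcarrier (a : Fin 3 → ℝ) (p : ℝ[X]) : (fun _ => p) ∈ Rcarrier a :=
  ⟨![p, 0, 0, 0, 0], by simp⟩

open Polynomial in
theorem eq_of_mem_Rcarrier_of_eq_zero {a : Fin 3 → ℝ} (ha : ∀ i, a i < 0) {f : Fin 5 → ℝ[X]}
    (hf : f ∈ Rcarrier a) (h0 : f 0 = 0) (h1 : f 1 = 0) (h2 : f 2 = 0) (h3 : f 3 = 0) :
    ∃ q : ℝ[X], f = ![0, 0, 0, 0, X ^ 3 * q] := by
  obtain ⟨q, e0, e1, e2, e3, e4⟩ := hf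
  have n0 : a 0 ≠ 0 := (ha 0).ne
  have n1 : a 1 ≠ 0 := (ha 1).ne
  have n2 : a 2 ≠ 0 := (ha 2).ne
  have n01 : a 0 + a 1 ≠ 0 := (add_neg (ha 0) (ha 1)).ne
  have n12 : a 1 + a 2 ≠ 0 := (add_neg (ha 1) (ha 2)).ne
  have q0 : q 0 = 0 := e0.symm.trans h0
  have q1 : q 1 = 0 := by
    rw [h1, q0, zero_add, eq_comm] at e1
    exact (mul_eq_zero.mp e1).resolve_left (mul_ne_zero (C_ne_zero.mpr n1) X_ne_zero)
  have q2 : q 2 = 0 := by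
    rw [h2, q0, q1, mul_zero, zero_add, zero_add, eq_comm] at e2
    exact (mul_eq_zero.mp e2).resolve_left
      (mul_ne_zero (C_ne_zero.mpr (mul_ne_zero n0 n01)) (pow_ne_zero 2 X_ne_zero))
  have q3 : q 3 = 0 := by
    rw [h3, q0, q1, mul_zero, zero_add, zero_add, eq_comm] at e3
    exact (mul_eq_zero.mp e3).resolve_left
      (mul_ne_zero (C_ne_zero.mpr (mul_ne_zero n2 n12)) (pow_ne_zero 2 X_ne_zero))
  refine ⟨q 4, ?_⟩
  ext1 i
  fin_cases i
  · exact h0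
  · exact h1
  · exact h2
  · exact h3
  · simpa [q0, q1, q2, q3] using e4

open Polynomial in
theorem mem_span_singleton_iff_exists_eq {a : Fin 3 → ℝ} {A : Subalgebra ℝ (Fin 5 → ℝ[X])}
    (hA : (A : Set (Fin 5 → ℝ[X])) = Rcarrier a)
    {u : A} (hu : (u : Fin 5 → ℝ[X]) = ![0, 0, 0, 0, X ^ 3]) (x : A) :
    x ∈ Ideal.span {u} ↔ ∃ q : ℝ[X], (x : Fin 5 → ℝ[X]) = ![0, 0, 0, 0, X ^ 3 * q] := by
  rw [Ideal.mem_span_singleton']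
  constructor
  · rintro ⟨c, rfl⟩
    refine ⟨(c : Fin 5 → ℝ[X]) 4, ?_⟩
    ext1 i
    fin_cases i <;> simp [hu, mul_comm]
  · rintro ⟨q, hq⟩
    have hc : (fun _ => q) ∈ A := by
      rw [← SetLike.mem_coe, hA]
      exact const_mem_Rcarrier a q
    refine ⟨⟨fun _ => q, hc⟩, Subtype.ext ?_⟩
    ext1 i
    fin_cases i <;> simp [hu, hq, mul_comm]

/-- Let `R` be the subalgebra of `ℝ[ν]⁵` with carrier `Rcarrier a` (`a₁,a₂,a₃ < 0`), and
let `K₋` be the ideal of `R` generated by the single element `u = (0,0,0,0,ν³)`.  Then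
`K₋ = {x ∈ R : x₁ = x₂ = x₃ = x₄ = 0} = {(0,0,0,0,ν³q) : q ∈ ℝ[ν]}`. -/
theorem Kminus_description (a : Fin 3 → ℝ) (ha : ∀ i, a i < 0)
    (A : Subalgebra ℝ (Fin 5 → Polynomial ℝ))
    (hA : (A : Set (Fin 5 → Polynomial ℝ)) = Rcarrier a)
    (u : A) (hu : (u : Fin 5 → Polynomial ℝ) = ![0, 0, 0, 0, Polynomial.X ^ 3]) :
    ((Ideal.span {u} : Ideal A) : Set A) =
      {x : A | (x : Fin 5 → Polynomial ℝ) 0 = 0 ∧ (x : Fin 5 → Polynomial ℝ) 1 = 0 ∧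
               (x : Fin 5 → Polynomial ℝ) 2 = 0 ∧ (x : Fin 5 → Polynomial ℝ) 3 = 0} ∧
    ((Ideal.span {u} : Ideal A) : Set A) =
      {x : A | ∃ q : Polynomial ℝ,
        (x : Fin 5 → Polynomial ℝ) = ![0, 0, 0, 0, Polynomial.X ^ 3 * q]} := by
  have hspan := mem_span_singleton_iff_exists_eq hA hu
  refine ⟨Set.ext fun x => (hspan x).trans ⟨?_, ?_⟩, Set.ext hspan⟩
  · rintro ⟨q, hq⟩
    simp [hq]
  · rintro ⟨h0, h1, h2, h3⟩
    exact eq_of_mem_Rcarrier_of_eq_zero ha (hA ▸ x.2) h0 h1 h2 h3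
end

section
/- Let a₁,a₂,a₃ be negative real numbers, R the subalgebra of ℝ[ν]⁵ defined above, K₋ the ideal of R generated by (0,0,0,0,ν³), and K₊ = {x ∈ R : x₅ = 0}. Then there is an isomorphism of ℝ-algebras R/(K₋+K₊) ≅ ℝ[x]/(x³) sending the coset of the diagonal element (ν,ν,ν,ν,ν) to the class of x; with ν and x both placed in degree 2, this isomorphism is degree-preserving. In particular the symplectic quotient X ⫽_λ S(r₀) has the same real cohomology ring as ℂP², namely ℝ[x]/(x³) with x in degree 2. -/
/-- Evaluating a polynomial at the diagonal element `(ν,…,ν)` gives the diagonal tuple. -/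
theorem aeval_diagonal_apply {ι : Type*} {A : Subalgebra ℝ (ι → Polynomial ℝ)} {d : A}
    (hd : (d : ι → Polynomial ℝ) = fun _ => Polynomial.X) (p : Polynomial ℝ) (i : ι) :
    (Polynomial.aeval d p : A).1 i = p := by
  have h := Polynomial.aeval_algHom_apply
    ((Pi.evalAlgHom ℝ (fun _ : ι => Polynomial ℝ) i).comp A.val) d p
  have hX : ((Pi.evalAlgHom ℝ (fun _ : ι => Polynomial ℝ) i).comp A.val) d = Polynomial.X :=
    congrFun hd i
  rw [hX, Polynomial.aeval_X_left_apply] at h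
  exact h.symm

/-- The last component of an element of `A`, reduced modulo `X ^ 3`. -/
noncomputable def lastComponentMod (A : Subalgebra ℝ (Fin 5 → Polynomial ℝ)) :
    A →ₐ[ℝ] Polynomial ℝ ⧸ Ideal.span {(Polynomial.X : Polynomial ℝ) ^ 3} :=
  (Ideal.Quotient.mkₐ ℝ _).comp
    ((Pi.evalAlgHom ℝ (fun _ : Fin 5 => Polynomial ℝ) 4).comp A.val)

theorem lastComponentMod_apply (A : Subalgebra ℝ (Fin 5 → Polynomial ℝ)) (f : A) :
    lastComponentMod A f = Ideal.Quotient.mk _ ((f : Fin 5 → Polynomial ℝ) 4) :=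
  rfl

theorem lastComponentMod_surjective {A : Subalgebra ℝ (Fin 5 → Polynomial ℝ)} {d : A}
    (hd : (d : Fin 5 → Polynomial ℝ) = fun _ => Polynomial.X) :
    Function.Surjective (lastComponentMod A) := by
  intro y
  obtain ⟨p, rfl⟩ := Ideal.Quotient.mk_surjective y
  exact ⟨Polynomial.aeval d p, by rw [lastComponentMod_apply, aeval_diagonal_apply hd]⟩

theorem span_add_eq_ker_lastComponentMod {A : Subalgebra ℝ (Fin 5 → Polynomial ℝ)} {d u : A}
    (hd : (d : Fin 5 → Polynomial ℝ) = fun _ => Polynomial.X)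
    (hu : (u : Fin 5 → Polynomial ℝ) 4 = Polynomial.X ^ 3)
    {Kp : Ideal A} (hKp : ∀ x : A, x ∈ Kp ↔ (x : Fin 5 → Polynomial ℝ) 4 = 0) :
    Ideal.span {u} + Kp = RingHom.ker (lastComponentMod A) := by
  apply le_antisymm
  · refine sup_le ?_ fun x hx => ?_
    · rw [Ideal.span_singleton_le_iff_mem, RingHom.mem_ker, lastComponentMod_apply, hu,
        Ideal.Quotient.eq_zero_iff_mem]
      exact Ideal.mem_span_singleton_self _
    · rw [RingHom.mem_ker, lastComponentMod_apply, (hKp x).1 hx, map_zero]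
  · intro f hf
    rw [RingHom.mem_ker, lastComponentMod_apply, Ideal.Quotient.eq_zero_iff_mem,
      Ideal.mem_span_singleton'] at hf
    obtain ⟨g, hg⟩ := hf
    refine Submodule.mem_sup.2 ⟨Polynomial.aeval d g * u,
      Ideal.mul_mem_left _ _ (Ideal.mem_span_singleton_self u),
      f - Polynomial.aeval d g * u, (hKp _).2 ?_, add_sub_cancel _ _⟩
    change f.1 4 - (Polynomial.aeval d g : A).1 4 * u.1 4 = 0
    rw [aeval_diagonal_apply hd, hu, hg, sub_self]

set_option synthInstance.maxHeartbeats 1000000 in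
set_option maxHeartbeats 1000000 in
/-- Let `R` be the subalgebra of `ℝ[ν]⁵` with carrier `Rcarrier a` (`a₁,a₂,a₃ < 0`),
`K₋` the ideal of `R` generated by `u = (0,0,0,0,ν³)`, and `K₊` the ideal of all
`x ∈ R` with `x₅ = 0`.  Then there is an isomorphism of ℝ-algebras
`R/(K₋+K₊) ≅ ℝ[x]/(x³)` sending the coset of the diagonal element `(ν,ν,ν,ν,ν)` to the
class of `x`: the symplectic quotient `X ⫽_λ S(r₀)` has the real cohomology ring of
`ℂP²`. -/
theorem quotient_iso_cohomology_CP2 (a : Fin 3 → ℝ) (ha : ∀ i, a i < 0)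
    (A : Subalgebra ℝ (Fin 5 → Polynomial ℝ))
    (hA : (A : Set (Fin 5 → Polynomial ℝ)) = Rcarrier a)
    (u : A) (hu : (u : Fin 5 → Polynomial ℝ) = ![0, 0, 0, 0, Polynomial.X ^ 3])
    (Kp : Ideal A) (hKp : ∀ x : A, x ∈ Kp ↔ (x : Fin 5 → Polynomial ℝ) 4 = 0)
    (eν : A) (heν : (eν : Fin 5 → Polynomial ℝ) = fun _ => Polynomial.X) :
    ∃ Φ : (A ⧸ (Ideal.span {u} + Kp : Ideal A)) ≃ₐ[ℝ]
          (Polynomial ℝ ⧸ Ideal.span {(Polynomial.X : Polynomial ℝ) ^ 3}),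
      Φ (Ideal.Quotient.mk (Ideal.span {u} + Kp : Ideal A) eν) =
        Ideal.Quotient.mk (Ideal.span {(Polynomial.X : Polynomial ℝ) ^ 3}) Polynomial.X := by
  have hker := span_add_eq_ker_lastComponentMod heν (by rw [hu]; rfl) hKp
  refine ⟨(Ideal.quotientEquivAlgOfEq ℝ hker).trans
    (Ideal.quotientKerAlgEquivOfSurjective (lastComponentMod_surjective heν)), ?_⟩
  change lastComponentMod A eν = _
  rw [lastComponentMod_apply, heν]
end
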